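/- Assume [H2]. For all ψ₁, ψ₂ ∈ D^{σ,p}(𝕋ⁿ), one has ‖φ_{ψ₁} − φ_{ψ₂}‖_{L^p} ≤ C¹_{ψ₁,ψ₂} ‖ψ₁ − ψ₂‖_{L^p} and ‖∂_{x₁}(φ_{ψ₁} − φ_{ψ₂})‖_{L^p} ≤ C²_{ψ₁,ψ₂} ‖ψ₁ − ψ₂‖_{W^{1,p}}, where C¹_{ψ₁,ψ₂} := C · min(‖ψ₁‖_{W^{1,p}}, ‖ψ₂‖_{W^{1,p}}) / (min ψ̄₁ · min ψ̄₂) and C²_{ψ₁,ψ₂} := C · min(‖ψ₁‖_{W^{σ,p}}, ‖ψ₂‖_{W^{σ,p}}) / (min ψ̄₁ · min ψ̄₂) + C · ‖ψ₁‖_{W^{σ,p}} ‖ψ₂‖_{W^{σ,p}} (‖ψ₁‖_{W^{σ,p}} + ‖ψ₂‖_{W^{σ,p}}) / ((min ψ̄₁)² (min ψ̄₂)²), with a constant C depending only on the potential V. -/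

import Mathlib

open MeasureTheory ENNReal Set Filter

noncomputable section

/-- Ambient space `ℝ × ℝ^m`: the universal cover of the torus `𝕋^{m+1}` (so `n = m + 1`). -/
abbrev Spc (m : ℕ) : Type := ℝ × (Fin m → ℝ)

/-- Unit cube in the last `m` coordinates: a fundamental domain for `𝕋^m`. -/
def cube1 (m : ℕ) : Set (Fin m → ℝ) := Set.pi Set.univ fun _ => Set.Ico (0 : ℝ) 1

/-- A fundamental domain for the torus `𝕋^{m+1}`. -/
def cube (m : ℕ) : Set (Spc m) := Set.Ico (0 : ℝ) 1 ×ˢ cube1 m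

/-- The measure of the torus: Lebesgue measure restricted to a fundamental domain. -/
def μT (m : ℕ) : Measure (Spc m) := volume.restrict (cube m)

/-- `ℤ^{m+1}`-periodicity: `f` is a function on the torus `𝕋^{m+1}`. -/
def IsPeriodic {m : ℕ} (f : Spc m → ℝ) : Prop :=
  ∀ (x : Spc m) (k : ℤ) (j : Fin m → ℤ), f (x.1 + k, fun i => x.2 i + j i) = f x

/-- The first coordinate direction. -/
def e1 (m : ℕ) : Spc m := (1, 0)

/-- The remaining coordinate directions. -/
def eC (m : ℕ) (i : Fin m) : Spc m := (0, Pi.single i 1)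

/-- Partial derivative in the direction `v`. -/
def pd {m : ℕ} (v : Spc m) (f : Spc m → ℝ) (x : Spc m) : ℝ := fderiv ℝ f x v

/-- `∇f ⋅ ∇g`. -/
def gradDot {m : ℕ} (f g : Spc m → ℝ) (x : Spc m) : ℝ :=
  pd (e1 m) f x * pd (e1 m) g x + ∑ i, pd (eC m i) f x * pd (eC m i) g x

/-- The Laplacian. -/
def lap {m : ℕ} (f : Spc m → ℝ) (x : Spc m) : ℝ :=
  pd (e1 m) (pd (e1 m) f) x + ∑ i, pd (eC m i) (pd (eC m i) f) x

/-- The marginal `ψ̄(x₁) = ∫_{𝕋^m} ψ(x₁, ⋅)`. -/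
def marg {m : ℕ} (ψ : Spc m → ℝ) (x1 : ℝ) : ℝ := ∫ y in cube1 m, ψ (x1, y)

/-- The nonlocal coefficient `φ_ψ = (∫ ∂_{x₁}V ψ dx₂…dxₙ) / ψ̄`. -/
def phiF {m : ℕ} (V ψ : Spc m → ℝ) (x1 : ℝ) : ℝ :=
  (∫ y in cube1 m, pd (e1 m) V (x1, y) * ψ (x1, y)) / marg ψ x1

/-- `F(ψ) = ∇V⋅∇ψ + ΔV ψ − ∂_{x₁}(φ_ψ ψ)`. -/
def Fop {m : ℕ} (V ψ : Spc m → ℝ) (x : Spc m) : ℝ :=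
  gradDot V ψ x + lap V x * ψ x - pd (e1 m) (fun z => phiF V ψ z.1 * ψ z) x

/-- `L^p`-norm on the torus. -/
def LpN {m : ℕ} (p : ℝ) (f : Spc m → ℝ) : ℝ≥0∞ := eLpNorm f (ENNReal.ofReal p) (μT m)

/-- Gagliardo (Sobolev–Slobodeckij) seminorm of fractional order `s`. -/
def gagl {m : ℕ} {F : Type*} [NormedAddCommGroup F] (s p : ℝ) (f : Spc m → F) : ℝ≥0∞ :=
  (∫⁻ x in cube m, ∫⁻ y in cube m,
      ENNReal.ofReal (‖f x - f y‖ ^ p / ‖x - y‖ ^ ((m : ℝ) + 1 + s * p))) ^ (1 / p)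

/-- The differential of `f`. -/
def grd {m : ℕ} (f : Spc m → ℝ) (x : Spc m) : Spc m →L[ℝ] ℝ := fderiv ℝ f x

/-- The `W^{σ,p}`-norm on the torus, for `0 ≤ σ ≤ 2`. -/
def WNorm {m : ℕ} (σ p : ℝ) (f : Spc m → ℝ) : ℝ≥0∞ :=
  if σ ≤ 0 then LpN p f
  else if σ < 1 then LpN p f + gagl σ p f
  else if σ < 2 then
    LpN p f + eLpNorm (fun x => ‖grd f x‖) (ENNReal.ofReal p) (μT m)
      + (if σ = 1 then 0 else gagl (σ - 1) p (grd f))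
  else
    LpN p f + eLpNorm (fun x => ‖grd f x‖) (ENNReal.ofReal p) (μT m)
      + eLpNorm (fun x => ‖iteratedFDeriv ℝ 2 f x‖) (ENNReal.ofReal p) (μT m)

/-- Membership in `W^{σ,p}(𝕋^{m+1})`, for `0 ≤ σ ≤ 2`. -/
def MemW {m : ℕ} (σ p : ℝ) (f : Spc m → ℝ) : Prop :=
  IsPeriodic f ∧ Measurable f ∧ (1 ≤ σ → Differentiable ℝ f) ∧
    (2 ≤ σ → Differentiable ℝ (grd f)) ∧ WNorm σ p f < ⊤

/-- Membership in `𝒟^{σ,p}(𝕋^{m+1}) = {ψ ∈ W^{σ,p} | ψ̄ > 0}`. -/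
def MemD {m : ℕ} (σ p : ℝ) (f : Spc m → ℝ) : Prop :=
  MemW σ p f ∧ ∀ x1 : ℝ, 0 < marg f x1

/-- Hypothesis `[H₁]`: `ψ₀ ∈ 𝒟^{σ,p}`, `ψ₀ ≥ 0`, `∫ ψ₀ = 1`. -/
def Hyp1 {m : ℕ} (σ p : ℝ) (ψ0 : Spc m → ℝ) : Prop :=
  MemD σ p ψ0 ∧ (∀ x, 0 ≤ ψ0 x) ∧ (∫ x in cube m, ψ0 x) = 1

/-- Hypothesis `[H₂]`: `n = m + 1 ≥ 2`, `p > n`, `σ ∈ (1 + n/p, 2)`. -/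
def Hyp2 (m : ℕ) (σ p : ℝ) : Prop :=
  1 ≤ m ∧ (m : ℝ) + 1 < p ∧ 1 + ((m : ℝ) + 1) / p < σ ∧ σ < 2

/-- The real interval `[0, Tmax)`, where `Tmax ∈ (0, ∞]`. -/
def Ico0 (Tmax : ℝ≥0∞) : Set ℝ := {t : ℝ | 0 ≤ t ∧ ENNReal.ofReal t < Tmax}

/-- The real interval `(0, Tmax)`, where `Tmax ∈ (0, ∞]`. -/
def Ioo0 (Tmax : ℝ≥0∞) : Set ℝ := {t : ℝ | 0 < t ∧ ENNReal.ofReal t < Tmax}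

/-- Continuity in `W^{σ,p}`-norm of a curve, on a time set `s`. -/
def ContW {m : ℕ} (σ p : ℝ) (s : Set ℝ) (ψ : ℝ → Spc m → ℝ) : Prop :=
  ∀ t ∈ s, ∀ ε : ℝ, 0 < ε → ∃ δ > 0, ∀ t' ∈ s, |t' - t| < δ →
    WNorm σ p (fun x => ψ t' x - ψ t x) < ENNReal.ofReal ε

/-- Hölder continuity (exponent `α`) in `W^{σ,p}`-norm of a curve, on a time set `s`. -/
def HolderW {m : ℕ} (α σ p : ℝ) (s : Set ℝ) (ψ : ℝ → Spc m → ℝ) : Prop :=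
  ∃ C : ℝ, ∀ t ∈ s, ∀ t' ∈ s,
    WNorm σ p (fun x => ψ t' x - ψ t x) ≤ ENNReal.ofReal (C * |t' - t| ^ α)

/-- `ψ` is an `L^p`-solution on `[0, Tmax)` of the nonlocal Fokker–Planck equation
`∂ₜψ = div(∇V ψ + β⁻¹∇ψ) − ∂_{x₁}(φ_ψ ψ) = β⁻¹Δψ + F(ψ)`, `ψ(0) = ψ₀`. -/
structure IsLpSolution {m : ℕ} (V : Spc m → ℝ) (β σ p : ℝ) (ψ0 : Spc m → ℝ)
    (Tmax : ℝ≥0∞) (ψ : ℝ → Spc m → ℝ) : Prop where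
  init : ∀ x, ψ 0 x = ψ0 x
  contLp : ContW 0 p (Ico0 Tmax) ψ
  regW2 : ∀ t ∈ Ioo0 Tmax, MemW 2 p (ψ t)
  regD : ∀ t ∈ Ioo0 Tmax, MemD σ p (ψ t)
  eqn : ∀ t ∈ Ioo0 Tmax,
    Tendsto (fun h : ℝ => LpN p
        (fun x => (ψ (t + h) x - ψ t x) / h - (β⁻¹ * lap (ψ t) x + Fop V (ψ t) x)))
      (nhdsWithin 0 {h : ℝ | h ≠ 0}) (nhds 0)
  derivCont : ContW 0 p (Ioo0 Tmax)
    (fun t x => β⁻¹ * lap (ψ t) x + Fop V (ψ t) x)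

/-- A maximal `L^p`-solution: an `L^p`-solution admitting no proper extension. -/
def IsMaximalLpSolution {m : ℕ} (V : Spc m → ℝ) (β σ p : ℝ) (ψ0 : Spc m → ℝ)
    (Tmax : ℝ≥0∞) (ψ : ℝ → Spc m → ℝ) : Prop :=
  IsLpSolution V β σ p ψ0 Tmax ψ ∧ 0 < Tmax ∧
    ∀ (Tmax' : ℝ≥0∞) (ψ' : ℝ → Spc m → ℝ), IsLpSolution V β σ p ψ0 Tmax' ψ' →
      (∀ t ∈ Ico0 Tmax, ψ' t = ψ t) → Tmax' ≤ Tmax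

/-- The Euclidean quadratic form on `Spc m`. -/
def qd {m : ℕ} (z : Spc m) : ℝ := z.1 ^ 2 + ∑ i, z.2 i ^ 2

/-- The heat semigroup `e^{β⁻¹ t Δ}` on the torus, realized by convolution with the Gaussian
heat kernel on the universal cover (and the identity for `t ≤ 0`). -/
def heatSG {m : ℕ} (β t : ℝ) (f : Spc m → ℝ) (x : Spc m) : ℝ :=
  if t ≤ 0 then f x
  else ∫ y : Spc m, (4 * Real.pi * (t / β)) ^ (-((m : ℝ) + 1) / 2) *
      Real.exp (-qd (x - y) / (4 * (t / β))) * f y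

/-- `ψ` is a mild solution of the nonlocal Fokker–Planck equation on `[0, Tmax)`:
`ψ ∈ C([0,Tmax), 𝒟^{σ,p})` and `ψ(t) = e^{β⁻¹tΔ}ψ₀ + ∫₀ᵗ e^{β⁻¹(t−s)Δ} F(ψ(s)) ds`. -/
def IsMildSolution {m : ℕ} (V : Spc m → ℝ) (β σ p : ℝ) (ψ0 : Spc m → ℝ)
    (Tmax : ℝ≥0∞) (ψ : ℝ → Spc m → ℝ) : Prop :=
  (∀ x, ψ 0 x = ψ0 x) ∧ (∀ t ∈ Ico0 Tmax, MemD σ p (ψ t)) ∧ ContW σ p (Ico0 Tmax) ψ ∧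
    ∀ t ∈ Ico0 Tmax, ∀ᵐ x ∂(volume : Measure (Spc m)),
      ψ t x = heatSG β t ψ0 x + ∫ s in Set.Ioc (0 : ℝ) t, heatSG β (t - s) (Fop V (ψ s)) x

/-- A maximal mild solution. -/
def IsMaximalMildSolution {m : ℕ} (V : Spc m → ℝ) (β σ p : ℝ) (ψ0 : Spc m → ℝ)
    (Tmax : ℝ≥0∞) (ψ : ℝ → Spc m → ℝ) : Prop :=
  IsMildSolution V β σ p ψ0 Tmax ψ ∧ 0 < Tmax ∧
    ∀ (Tmax' : ℝ≥0∞) (ψ' : ℝ → Spc m → ℝ), IsMildSolution V β σ p ψ0 Tmax' ψ' →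
      (∀ t ∈ Ico0 Tmax, ψ' t = ψ t) → Tmax' ≤ Tmax

/-- `L^p`-norm on the one-dimensional torus `𝕋`. -/
def LpN1 (p : ℝ) (g : ℝ → ℝ) : ℝ≥0∞ :=
  eLpNorm g (ENNReal.ofReal p) (volume.restrict (Set.Ico (0 : ℝ) 1))

/-- Membership in `L^p₀(𝕋^{m+1})`: periodic, `L^p` and of mean zero. -/
def MemL0 {m : ℕ} (p : ℝ) (f : Spc m → ℝ) : Prop :=
  IsPeriodic f ∧ Measurable f ∧ LpN p f < ⊤ ∧ (∫ x in cube m, f x) = 0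

lemma cube1_ae (m : ℕ) : cube1 m =ᵐ[volume] Set.Icc (0 : Fin m → ℝ) 1 := by
  unfold cube1
  exact Measure.univ_pi_Ico_ae_eq_Icc (f := (0 : Fin m → ℝ)) (g := 1)

instance probNu (m : ℕ) : IsProbabilityMeasure (volume.restrict (cube1 m)) := by
  constructor
  rw [Measure.restrict_congr_set (cube1_ae m)]
  simp [Real.volume_Icc_pi]

instance probOne : IsProbabilityMeasure (volume.restrict (Set.Ico (0 : ℝ) 1)) := by
  constructor
  simp

lemma muT_eq (m : ℕ) :
    μT m = (volume.restrict (Set.Ico (0 : ℝ) 1)).prod (volume.restrict (cube1 m)) := by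
  rw [Measure.prod_restrict, μT, cube, Measure.volume_eq_prod]

instance probT (m : ℕ) : IsProbabilityMeasure (μT m) := by
  rw [muT_eq]; infer_instance

lemma marg_cont {m : ℕ} {g : Spc m → ℝ} (hg : Continuous g) : Continuous (marg g) := by
  have : marg g = fun x => ∫ y in Set.Icc (0 : Fin m → ℝ) 1, g (x, y) := by
    funext x
    rw [marg, Measure.restrict_congr_set (cube1_ae m)]
  rw [this]
  exact continuous_parametric_integral_of_continuous (f := fun x y => g (x, y)) hg isCompact_Icc

lemma slice_int {m : ℕ} {g : Spc m → ℝ} (hg : Continuous g) (x : ℝ) :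
    Integrable (fun y => g (x, y)) (volume.restrict (cube1 m)) := by
  rw [Measure.restrict_congr_set (cube1_ae m)]
  exact (Continuous.continuousOn (by fun_prop)).integrableOn_compact isCompact_Icc

lemma eLp_marg {m : ℕ} {g : Spc m → ℝ} (hg : Measurable g) {q : ℝ≥0∞} (h1 : 1 ≤ q) (ht : q ≠ ⊤) :
    eLpNorm (marg g) q (volume.restrict (Set.Ico (0 : ℝ) 1)) ≤ eLpNorm g q (μT m) := by
  have h0 : q ≠ 0 := by rintro rfl; simp at h1
  have hq : 0 < q.toReal := ENNReal.toReal_pos h0 ht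
  rw [eLpNorm_eq_lintegral_rpow_enorm_toReal h0 ht, eLpNorm_eq_lintegral_rpow_enorm_toReal h0 ht,
    muT_eq, lintegral_prod _ (by fun_prop)]
  gcongr with x
  have e1 : ‖marg g x‖ₑ ≤ eLpNorm (fun y => g (x, y)) q (volume.restrict (cube1 m)) := by
    refine le_trans (enorm_integral_le_lintegral_enorm _) ?_
    rw [← eLpNorm_one_eq_lintegral_enorm]
    exact eLpNorm_le_eLpNorm_of_exponent_le h1
      (hg.comp (by fun_prop : Measurable fun y => (x, y))).aestronglyMeasurable
  calc ‖marg g x‖ₑ ^ q.toReal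
      ≤ (eLpNorm (fun y => g (x, y)) q (volume.restrict (cube1 m))) ^ q.toReal := by gcongr
    _ = _ := by
      rw [eLpNorm_eq_lintegral_rpow_enorm_toReal h0 ht, ← ENNReal.rpow_mul]
      simp [hq.ne']

lemma pd_meas {m : ℕ} (g : Spc m → ℝ) : Measurable (pd (e1 m) g) :=
  measurable_fderiv_apply_const ℝ g (e1 m)

lemma line_deriv {m : ℕ} {g : Spc m → ℝ} (hg : Differentiable ℝ g) (x : ℝ) (y : Fin m → ℝ) :
    HasDerivAt (fun s => g (s, y)) (pd (e1 m) g (x, y)) x := by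
  have h := (hg (x, y)).hasFDerivAt
  have h2 : HasDerivAt (fun s : ℝ => ((s, y) : Spc m)) (e1 m) x :=
    (hasDerivAt_id x).prodMk (hasDerivAt_const x y)
  exact h.comp_hasDerivAt x h2

lemma D_int {m : ℕ} {g : Spc m → ℝ} (hi : Integrable g (μT m)) {a b : ℝ}
    (ha : a ∈ Set.Icc (0 : ℝ) 1) (hb : b ∈ Set.Icc (0 : ℝ) 1) :
    IntervalIntegrable (marg g) volume a b := by
  rw [muT_eq] at hi
  have h := hi.integral_prod_left
  rw [Measure.restrict_congr_set Ico_ae_eq_Ioc] at h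
  have h3 : IntervalIntegrable (marg g) volume 0 1 :=
    (intervalIntegrable_iff_integrableOn_Ioc_of_le zero_le_one).2 h
  refine h3.mono_set ?_
  rw [Set.uIcc_of_le (zero_le_one : (0 : ℝ) ≤ 1)]
  exact Set.uIcc_subset_Icc ha hb

lemma marg_ftc {m : ℕ} {g : Spc m → ℝ} (hg : Differentiable ℝ g)
    (hi : Integrable (pd (e1 m) g) (μT m)) {x : ℝ} (hx : x ∈ Set.Icc (0 : ℝ) 1) :
    marg g x = marg g 0 + ∫ s in (0 : ℝ)..x, marg (pd (e1 m) g) s := by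
  have hi' := hi
  rw [muT_eq, Measure.restrict_congr_set Ico_ae_eq_Ioc] at hi'
  have hle : volume.restrict (Set.Ioc 0 x) ≤ volume.restrict (Set.Ioc (0 : ℝ) 1) :=
    Measure.restrict_mono (Set.Ioc_subset_Ioc_right hx.2) le_rfl
  have hi2 : Integrable (pd (e1 m) g)
      ((volume.restrict (Set.Ioc 0 x)).prod (volume.restrict (cube1 m))) :=
    hi'.mono_measure (Measure.prod_mono hle le_rfl)
  rw [intervalIntegral.integral_of_le hx.1]
  have hsw := integral_integral_swap (f := fun s y => pd (e1 m) g (s, y)) hi2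
  unfold marg
  rw [hsw, ← sub_eq_iff_eq_add', ← integral_sub (slice_int hg.continuous x)
    (slice_int hg.continuous 0)]
  apply integral_congr_ae
  filter_upwards [hi2.prod_left_ae] with y hy
  rw [← intervalIntegral.integral_of_le hx.1]
  symm
  exact intervalIntegral.integral_eq_sub_of_hasDerivAt (f := fun s => g (s, y))
    (fun s _ => line_deriv hg s y)
    ((intervalIntegrable_iff_integrableOn_Ioc_of_le hx.1).2 hy)

lemma marg_deriv {m : ℕ} {g : Spc m → ℝ} (hg : Differentiable ℝ g)
    (hi : Integrable (pd (e1 m) g) (μT m)) :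
    ∀ᵐ x ∂(volume.restrict (Set.Ico (0 : ℝ) 1)),
      HasDerivAt (marg g) (marg (pd (e1 m) g) x) x := by
  have h := (D_int hi (a := 0) (b := 1) (by simp) (by simp)).ae_hasDerivAt_integral
  rw [Measure.restrict_congr_set Ioo_ae_eq_Ico.symm, ae_restrict_iff' measurableSet_Ioo]
  filter_upwards [h] with x hx hx1
  have h1 := hx (by rw [Set.uIcc_of_le zero_le_one]; exact ⟨hx1.1.le, hx1.2.le⟩) 0 (by simp)
  refine (h1.const_add (marg g 0)).congr_of_eventuallyEq ?_
  filter_upwards [Ioo_mem_nhds hx1.1 hx1.2] with z hz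
  exact marg_ftc hg hi ⟨hz.1.le, hz.2.le⟩

lemma marg_sup {m : ℕ} {g : Spc m → ℝ} (hg : Differentiable ℝ g)
    (hi : Integrable (pd (e1 m) g) (μT m)) {x : ℝ} (hx : x ∈ Set.Ico (0 : ℝ) 1) :
    ‖marg g x‖ₑ ≤ eLpNorm g 1 (μT m) + eLpNorm (pd (e1 m) g) 1 (μT m) := by
  have hx' : x ∈ Set.Icc (0 : ℝ) 1 := ⟨hx.1, hx.2.le⟩
  set J := ∫⁻ s in Set.Ico (0 : ℝ) 1, ‖marg (pd (e1 m) g) s‖ₑ with hJ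
  have key : ∀ t ∈ Set.Ico (0 : ℝ) 1, ‖marg g x‖ₑ ≤ ‖marg g t‖ₑ + J := by
    intro t ht
    have ht' : t ∈ Set.Icc (0 : ℝ) 1 := ⟨ht.1, ht.2.le⟩
    have e : marg g x = marg g t + ∫ s in t..x, marg (pd (e1 m) g) s := by
      rw [marg_ftc hg hi hx', marg_ftc hg hi ht', add_assoc,
        intervalIntegral.integral_add_adjacent_intervals (D_int hi (by simp) ht')
          (D_int hi ht' hx')]
    rw [e]
    refine (enorm_add_le _ _).trans ?_
    gcongr
    have : ‖∫ s in t..x, marg (pd (e1 m) g) s‖ₑ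
        ≤ ∫⁻ s in Set.uIoc t x, ‖marg (pd (e1 m) g) s‖ₑ := by
      rw [← ofReal_norm, intervalIntegral.norm_integral_eq_norm_integral_uIoc,
        ofReal_norm]
      exact enorm_integral_le_lintegral_enorm _
    refine this.trans ?_
    rw [hJ, Measure.restrict_congr_set Ico_ae_eq_Ioc]
    apply lintegral_mono_set
    intro s hs
    rw [Set.mem_uIoc] at hs
    rcases hs with hs | hs
    · exact ⟨ht.1.trans_lt hs.1, hs.2.trans hx.2.le⟩
    · exact ⟨hx.1.trans_lt hs.1, hs.2.trans ht.2.le⟩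
  calc ‖marg g x‖ₑ = ∫⁻ t in Set.Ico (0 : ℝ) 1, ‖marg g x‖ₑ := by simp
    _ ≤ ∫⁻ t in Set.Ico (0 : ℝ) 1, (‖marg g t‖ₑ + J) :=
        setLIntegral_mono' measurableSet_Ico key
    _ = (∫⁻ t in Set.Ico (0 : ℝ) 1, ‖marg g t‖ₑ) + J := by
        rw [lintegral_add_right _ measurable_const]; simp
    _ ≤ _ := by
        rw [hJ, ← eLpNorm_one_eq_lintegral_enorm, ← eLpNorm_one_eq_lintegral_enorm]
        gcongr
        · exact eLp_marg hg.continuous.measurable le_rfl (by simp)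
        · exact eLp_marg (pd_meas g) le_rfl (by simp)

lemma WN1 {m : ℕ} (p : ℝ) (u : Spc m → ℝ) : WNorm 1 p u =
    LpN p u + eLpNorm (fun x => ‖grd u x‖) (ENNReal.ofReal p) (μT m) := by
  have h1 : ¬ ((1 : ℝ) ≤ 0) := by norm_num
  have h2 : (1 : ℝ) < 2 := by norm_num
  simp [WNorm, h1, h2]

lemma WN1_le {m : ℕ} {σ p : ℝ} (hσ : 1 < σ) (hσ2 : σ < 2) (u : Spc m → ℝ) :
    WNorm 1 p u ≤ WNorm σ p u := by
  rw [WN1]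
  have h1 : ¬ (σ ≤ 0) := by linarith
  have h2 : ¬ (σ < 1) := by linarith
  simp only [WNorm, h1, h2, hσ2, if_true, if_false]
  exact le_self_add

/-- `w` is a `C¹` weight bounded by `K` together with its first derivative on the cube. -/
def Wt {m : ℕ} (w : Spc m → ℝ) (K : ℝ) : Prop :=
  Differentiable ℝ w ∧ ∀ z ∈ cube m, |w z| ≤ K ∧ |pd (e1 m) w z| ≤ K

lemma cube_meas (m : ℕ) : MeasurableSet (cube m) := by
  unfold cube cube1
  exact measurableSet_Ico.prod (MeasurableSet.univ_pi fun _ => measurableSet_Ico)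

lemma ae_cube {m : ℕ} : ∀ᵐ z ∂(μT m), z ∈ cube m := ae_restrict_mem (cube_meas m)

lemma pd_mul {m : ℕ} {w u : Spc m → ℝ} (hw : Differentiable ℝ w) (hu : Differentiable ℝ u)
    (z : Spc m) : pd (e1 m) (fun z => w z * u z) z
      = w z * pd (e1 m) u z + u z * pd (e1 m) w z := by
  have := ((hw z).hasFDerivAt.mul (hu z).hasFDerivAt).fderiv
  unfold pd
  rw [show (fun z => w z * u z) = w * u from rfl, this]
  simp

lemma pd_le {m : ℕ} (u : Spc m → ℝ) (z : Spc m) : |pd (e1 m) u z| ≤ ‖grd u z‖ := by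
  have h := (fderiv ℝ u z).le_opNorm (e1 m)
  have h2 : ‖e1 m‖ = 1 := by
    simp [e1, Prod.norm_def]
  rw [h2, mul_one] at h
  exact h

lemma wu_Lp {m : ℕ} {w u : Spc m → ℝ} {K p : ℝ} (hw : Wt w K) :
    eLpNorm (fun z => w z * u z) (ENNReal.ofReal p) (μT m) ≤ ENNReal.ofReal K * LpN p u := by
  refine eLpNorm_le_mul_eLpNorm_of_ae_le_mul ?_ _
  filter_upwards [ae_cube] with z hz
  rw [norm_mul]
  gcongr
  exact (hw.2 z hz).1

lemma pdwu_Lp {m : ℕ} {w u : Spc m → ℝ} {K p : ℝ} (hw : Wt w K) (hK : 0 ≤ K) (hp : 1 ≤ p)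
    (hu : Differentiable ℝ u) :
    eLpNorm (pd (e1 m) fun z => w z * u z) (ENNReal.ofReal p) (μT m)
      ≤ ENNReal.ofReal K * WNorm 1 p u := by
  have hg : Measurable fun z => ‖grd u z‖ := (measurable_fderiv ℝ u).norm
  have hq : 1 ≤ ENNReal.ofReal p := by simpa using hp
  calc _ ≤ ENNReal.ofReal K * eLpNorm ((fun z => ‖u z‖) + fun z => ‖grd u z‖)
        (ENNReal.ofReal p) (μT m) := by
        refine eLpNorm_le_mul_eLpNorm_of_ae_le_mul ?_ _
        filter_upwards [ae_cube] with z hz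
        rw [pd_mul hw.1 hu]
        obtain ⟨h1, h2⟩ := hw.2 z hz
        have h3 := pd_le u z
        simp only [Pi.add_apply]
        rw [Real.norm_of_nonneg (by positivity : 0 ≤ ‖u z‖ + ‖grd u z‖)]
        refine (norm_add_le _ _).trans ?_
        rw [norm_mul, norm_mul, mul_add, add_comm]
        simp only [Real.norm_eq_abs]
        rw [mul_comm |u z|]
        gcongr
    _ ≤ _ := by
        rw [WN1]
        gcongr
        refine (eLpNorm_add_le hu.continuous.norm.aestronglyMeasurable
          hg.aestronglyMeasurable hq).trans ?_
        rw [eLpNorm_norm]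
        rfl

lemma pdwu_int {m : ℕ} {w u : Spc m → ℝ} {K p : ℝ} (hw : Wt w K) (hK : 0 ≤ K) (hp : 1 ≤ p)
    (hu : Differentiable ℝ u) (hf : WNorm 1 p u < ⊤) :
    Integrable (pd (e1 m) fun z => w z * u z) (μT m) := by
  have hq : 1 ≤ ENNReal.ofReal p := by simpa using hp
  have : MemLp (pd (e1 m) fun z => w z * u z) (ENNReal.ofReal p) (μT m) :=
    ⟨(pd_meas _).aestronglyMeasurable, (pdwu_Lp hw hK hp hu).trans_lt
      (ENNReal.mul_lt_top (by simp) hf)⟩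
  exact this.integrable hq

lemma est_a {m : ℕ} {w u : Spc m → ℝ} {K p : ℝ} (hw : Wt w K) (hK : 0 ≤ K) (hp : 1 ≤ p)
    (hu : Differentiable ℝ u) :
    LpN1 p (marg fun z => w z * u z) ≤ ENNReal.ofReal K * LpN p u := by
  have hq : 1 ≤ ENNReal.ofReal p := by simpa using hp
  exact (eLp_marg (hw.1.mul hu).continuous.measurable hq (by simp)).trans (wu_Lp hw)

lemma est_c {m : ℕ} {w u : Spc m → ℝ} {K p : ℝ} (hw : Wt w K) (hK : 0 ≤ K) (hp : 1 ≤ p)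
    (hu : Differentiable ℝ u) (hf : WNorm 1 p u < ⊤) :
    LpN1 p (deriv (marg fun z => w z * u z)) ≤ ENNReal.ofReal K * WNorm 1 p u := by
  have hq : 1 ≤ ENNReal.ofReal p := by simpa using hp
  have hd := marg_deriv (hw.1.mul hu) (pdwu_int hw hK hp hu hf)
  have : eLpNorm (deriv (marg fun z => w z * u z)) (ENNReal.ofReal p)
        (volume.restrict (Set.Ico (0 : ℝ) 1)) =
      eLpNorm (marg (pd (e1 m) fun z => w z * u z)) (ENNReal.ofReal p)
        (volume.restrict (Set.Ico (0 : ℝ) 1)) := by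
    apply eLpNorm_congr_ae
    filter_upwards [hd] with x hx
    exact hx.deriv
  rw [LpN1, this]
  exact (eLp_marg (pd_meas _) hq (by simp)).trans (pdwu_Lp hw hK hp hu)

lemma est_d {m : ℕ} {w u : Spc m → ℝ} {K p : ℝ} (hw : Wt w K) (hK : 0 ≤ K) (hp : 1 ≤ p)
    (hu : Differentiable ℝ u) (hf : WNorm 1 p u < ⊤) {x : ℝ} (hx : x ∈ Set.Ico (0 : ℝ) 1) :
    |marg (fun z => w z * u z) x| ≤ 2 * K * (WNorm 1 p u).toReal := by
  have hq : 1 ≤ ENNReal.ofReal p := by simpa using hp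
  have h1 := marg_sup (hw.1.mul hu) (pdwu_int hw hK hp hu hf) hx
  have h2 : eLpNorm (w * u) 1 (μT m) ≤ ENNReal.ofReal K * WNorm 1 p u := by
    refine (eLpNorm_le_eLpNorm_of_exponent_le hq
      (hw.1.mul hu).continuous.aestronglyMeasurable).trans ((wu_Lp hw).trans ?_)
    rw [WN1]
    gcongr
    exact le_self_add
  have h3 : eLpNorm (pd (e1 m) (w * u)) 1 (μT m) ≤ ENNReal.ofReal K * WNorm 1 p u :=
    (eLpNorm_le_eLpNorm_of_exponent_le hq (pd_meas _).aestronglyMeasurable).trans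
      (pdwu_Lp hw hK hp hu)
  have h4 := h1.trans (add_le_add h2 h3)
  have h5 := ENNReal.toReal_mono (by finiteness) h4
  rw [toReal_enorm, ENNReal.toReal_add (by finiteness) (by finiteness), ENNReal.toReal_mul,
    ENNReal.toReal_ofReal hK, Real.norm_eq_abs] at h5
  calc _ ≤ _ := h5
    _ = _ := by ring

lemma est_e {m : ℕ} {w u : Spc m → ℝ} {K p : ℝ} (hw : Wt w K) (hK : 0 ≤ K) (hp : 1 ≤ p)
    (hu : Differentiable ℝ u) (hf : WNorm 1 p u < ⊤) :
    ∀ᵐ x ∂(volume.restrict (Set.Ico (0 : ℝ) 1)),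
      DifferentiableAt ℝ (marg fun z => w z * u z) x := by
  filter_upwards [marg_deriv (hw.1.mul hu) (pdwu_int hw hK hp hu hf)] with x hx
  exact hx.differentiableAt

lemma marg_sub' {m : ℕ} {w u v : Spc m → ℝ} (hw : Differentiable ℝ w) (hu : Differentiable ℝ u)
    (hv : Differentiable ℝ v) (x : ℝ) :
    marg (fun z => w z * (u z - v z)) x
      = marg (fun z => w z * u z) x - marg (fun z => w z * v z) x := by
  unfold marg
  refine Eq.trans ?_ (integral_sub (slice_int (hw.mul hu).continuous x)
    (slice_int (hw.mul hv).continuous x))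
  congr 1
  funext y
  simp only [Pi.mul_apply]
  ring

lemma marg_inf_pos {m : ℕ} {u : Spc m → ℝ} (hu : Continuous u) (hper : IsPeriodic u)
    (hpos : ∀ x, 0 < marg u x) : 0 < ⨅ y, marg u y := by
  have hP : Function.Periodic (marg u) 1 := by
    intro x
    unfold marg
    congr 1
    funext y
    have := hper (x, y) 1 0
    simpa using this
  obtain ⟨a, ha, hmin⟩ := (isCompact_Icc (a := (0 : ℝ)) (b := 1)).exists_isMinOn (by simp)
    (marg_cont hu).continuousOn
  refine (hpos a).trans_le (le_ciInf fun y => ?_)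
  obtain ⟨z, hz, e⟩ := hP.exists_mem_Ico₀ one_pos y
  rw [e]
  exact hmin ⟨hz.1, hz.2.le⟩

lemma inf_le' {m : ℕ} {u : Spc m → ℝ} (hpos : ∀ x, 0 < marg u x) (x : ℝ) :
    ⨅ y, marg u y ≤ marg u x :=
  ciInf_le ⟨0, by rintro _ ⟨y, rfl⟩; exact (hpos y).le⟩ x

lemma exists_K {m : ℕ} {V : Spc m → ℝ} (hV : ContDiff ℝ 2 V) :
    ∃ K : ℝ, 1 ≤ K ∧ Wt (pd (e1 m) V) K ∧ Wt (fun _ : Spc m => (1 : ℝ)) K := by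
  have h1 : ContDiff ℝ 1 (pd (e1 m) V) := by
    have := hV.fderiv_right (m := 1) (by norm_num)
    exact this.clm_apply contDiff_const
  have h2 : Continuous (pd (e1 m) (pd (e1 m) V)) :=
    (h1.continuous_fderiv (by norm_num)).clm_apply continuous_const
  have hsub : cube m ⊆ Set.Icc (0 : ℝ) 1 ×ˢ Set.Icc (0 : Fin m → ℝ) 1 := by
    rintro ⟨a, b⟩ ⟨ha, hb⟩
    exact ⟨⟨ha.1, ha.2.le⟩, fun i => (hb i trivial).1, fun i => (hb i trivial).2.le⟩
  have hc : IsCompact (Set.Icc (0 : ℝ) 1 ×ˢ Set.Icc (0 : Fin m → ℝ) 1) :=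
    isCompact_Icc.prod isCompact_Icc
  obtain ⟨A, hA⟩ := hc.exists_bound_of_continuousOn h1.continuous.continuousOn
  obtain ⟨B, hB⟩ := hc.exists_bound_of_continuousOn h2.continuousOn
  refine ⟨max 1 (max A B), le_max_left _ _, ⟨h1.differentiable (by norm_num), fun z hz => ⟨?_, ?_⟩⟩,
    ⟨differentiable_const _, fun z hz => ⟨?_, ?_⟩⟩⟩
  · exact (hA z (hsub hz)).trans (by simp)
  · exact (hB z (hsub hz)).trans (by simp)
  · simp
  · simp [pd]

lemma lin4 {p : ℝ} (hp : 1 ≤ p) {F f1 f2 f3 f4 : ℝ → ℝ} (h1 : Measurable f1) (h2 : Measurable f2)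
    (h3 : Measurable f3) (h4 : Measurable f4) {c1 c2 c3 c4 : ℝ} (k1 : 0 ≤ c1) (k2 : 0 ≤ c2)
    (k3 : 0 ≤ c3) (k4 : 0 ≤ c4)
    (h : ∀ᵐ x ∂(volume.restrict (Set.Ico (0 : ℝ) 1)),
      |F x| ≤ c1 * |f1 x| + c2 * |f2 x| + c3 * |f3 x| + c4 * |f4 x|) :
    LpN1 p F ≤ ENNReal.ofReal c1 * LpN1 p f1 + ENNReal.ofReal c2 * LpN1 p f2
      + ENNReal.ofReal c3 * LpN1 p f3 + ENNReal.ofReal c4 * LpN1 p f4 := by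
  have hq : 1 ≤ ENNReal.ofReal p := by simpa using hp
  have key : ∀ (c : ℝ) (f : ℝ → ℝ), 0 ≤ c → eLpNorm (fun x => c * |f x|) (ENNReal.ofReal p)
      (volume.restrict (Set.Ico (0 : ℝ) 1)) ≤ ENNReal.ofReal c * LpN1 p f := by
    intro c f hc
    refine eLpNorm_le_mul_eLpNorm_of_ae_le_mul (Eventually.of_forall fun x => ?_) _
    rw [norm_mul, Real.norm_of_nonneg hc]
    simp
  have e : LpN1 p F ≤ eLpNorm ((((fun x => c1 * |f1 x|) + fun x => c2 * |f2 x|)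
      + fun x => c3 * |f3 x|) + fun x => c4 * |f4 x|) (ENNReal.ofReal p)
      (volume.restrict (Set.Ico (0 : ℝ) 1)) := by
    refine eLpNorm_mono_ae_real ?_
    filter_upwards [h] with x hx
    exact hx
  have m1 : Measurable fun x => c1 * |f1 x| := h1.abs.const_mul c1
  have m2 : Measurable fun x => c2 * |f2 x| := h2.abs.const_mul c2
  have m3 : Measurable fun x => c3 * |f3 x| := h3.abs.const_mul c3
  have m4 : Measurable fun x => c4 * |f4 x| := h4.abs.const_mul c4
  refine e.trans ?_
  refine (eLpNorm_add_le ((m1.add m2).add m3).aestronglyMeasurable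
    m4.aestronglyMeasurable hq).trans (add_le_add ?_ (key _ _ k4))
  refine (eLpNorm_add_le (m1.add m2).aestronglyMeasurable
    m3.aestronglyMeasurable hq).trans (add_le_add ?_ (key _ _ k3))
  exact (eLpNorm_add_le m1.aestronglyMeasurable
    m2.aestronglyMeasurable hq).trans (add_le_add (key _ _ k1) (key _ _ k2))

lemma alg1 {a1 a2 m1 m2 A1 A2 S : ℝ} (ha1 : 0 < a1) (ha2 : 0 < a2) (h1 : a1 ≤ m1) (h2 : a2 ≤ m2)
    (hA2 : |A2| ≤ S) (hm2 : |m2| ≤ S) :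
    |A1 / m1 - A2 / m2| ≤ S / (a1 * a2) * |A1 - A2| + S / (a1 * a2) * |m1 - m2| := by
  have p1 : 0 < m1 := ha1.trans_le h1
  have p2 : 0 < m2 := ha2.trans_le h2
  have e : A1 / m1 - A2 / m2 = m2 / (m1 * m2) * (A1 - A2) - A2 / (m1 * m2) * (m1 - m2) := by
    field_simp
    ring
  have hS : 0 ≤ S := (abs_nonneg _).trans hA2
  have q : 0 < m1 * m2 := mul_pos p1 p2
  rw [e]
  refine (abs_sub _ _).trans ?_
  rw [abs_mul, abs_mul, abs_div, abs_div, abs_of_pos q]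
  gcongr

lemma alg2 {a1 a2 m1 m2 A1 A2 B1 B2 r1 r2 s1 s2 t : ℝ} (ha1 : 0 < a1) (ha2 : 0 < a2)
    (h1 : a1 ≤ m1) (h2 : a2 ≤ m2) (hA1 : |A1| ≤ s1) (hm1 : |m1| ≤ s1)
    (hA2 : |A2| ≤ s2) (hm2 : |m2| ≤ s2) (hA : |A1 - A2| ≤ t) (hm : |m1 - m2| ≤ t) :
    |(B1 * m1 - A1 * r1) / m1 ^ 2 - (B2 * m2 - A2 * r2) / m2 ^ 2| ≤
      s2 / (a1 * a2) * |B1 - B2| + t / (a1 * a2) * |B2|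
      + s1 * s2 ^ 2 / (a1 ^ 2 * a2 ^ 2) * |r1 - r2|
      + 3 * s1 * s2 * t / (a1 ^ 2 * a2 ^ 2) * |r2| := by
  have p1 : 0 < m1 := ha1.trans_le h1
  have p2 : 0 < m2 := ha2.trans_le h2
  have e : (B1 * m1 - A1 * r1) / m1 ^ 2 - (B2 * m2 - A2 * r2) / m2 ^ 2 =
      m2 / (m1 * m2) * (B1 - B2) - (m1 - m2) / (m1 * m2) * B2
      - A1 * m2 ^ 2 / (m1 ^ 2 * m2 ^ 2) * (r1 - r2)
      - (m2 * ((A1 - A2) * m1 - A1 * (m1 - m2)) - A2 * m1 * (m1 - m2))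
        / (m1 ^ 2 * m2 ^ 2) * r2 := by
    field_simp
    ring
  have hs1 : 0 ≤ s1 := (abs_nonneg _).trans hA1
  have hs2 : 0 ≤ s2 := (abs_nonneg _).trans hA2
  have ht : 0 ≤ t := (abs_nonneg _).trans hA
  have q : 0 < m1 * m2 := mul_pos p1 p2
  have q2 : 0 < m1 ^ 2 * m2 ^ 2 := by positivity
  have b : |m2 * ((A1 - A2) * m1 - A1 * (m1 - m2)) - A2 * m1 * (m1 - m2)| ≤ 3 * s1 * s2 * t := by
    calc _ ≤ |m2 * ((A1 - A2) * m1 - A1 * (m1 - m2))| + |A2 * m1 * (m1 - m2)| := abs_sub _ _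
      _ ≤ |m2| * (|A1 - A2| * |m1| + |A1| * |m1 - m2|) + |A2| * |m1| * |m1 - m2| := by
          rw [abs_mul, abs_mul, abs_mul, ← abs_mul (A1 - A2), ← abs_mul A1]
          gcongr
          exact abs_sub _ _
      _ ≤ s2 * (t * s1 + s1 * t) + s2 * s1 * t := by gcongr
      _ = _ := by ring
  rw [e]
  refine (abs_sub _ _).trans (add_le_add ((abs_sub _ _).trans (add_le_add
    ((abs_sub _ _).trans (add_le_add ?_ ?_)) ?_)) ?_)
  · rw [abs_mul, abs_div, abs_of_pos q]; gcongr
  · rw [abs_mul, abs_div, abs_of_pos q]; gcongr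
  · rw [abs_mul, abs_div, abs_of_pos q2, abs_mul, abs_pow]; gcongr
  · rw [abs_mul, abs_div, abs_of_pos q2]; gcongr

lemma one_side {m : ℕ} {V : Spc m → ℝ} {K p : ℝ} (hK : 1 ≤ K) (hw : Wt (pd (e1 m) V) K)
    (ho : Wt (fun _ : Spc m => (1 : ℝ)) K) (hp : 1 ≤ p) {ψ1 ψ2 : Spc m → ℝ}
    (d1 : Differentiable ℝ ψ1) (d2 : Differentiable ℝ ψ2)
    (P1 : IsPeriodic ψ1) (P2 : IsPeriodic ψ2)
    (f1 : WNorm 1 p ψ1 < ⊤) (f2 : WNorm 1 p ψ2 < ⊤)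
    (g1 : ∀ x, 0 < marg ψ1 x) (g2 : ∀ x, 0 < marg ψ2 x) :
    (LpN1 p (fun x1 => phiF V ψ1 x1 - phiF V ψ2 x1) ≤
        ENNReal.ofReal (32 * K ^ 4) * (WNorm 1 p ψ2) /
            (ENNReal.ofReal (⨅ y : ℝ, marg ψ1 y) * ENNReal.ofReal (⨅ y : ℝ, marg ψ2 y)) *
          LpN p (fun x => ψ1 x - ψ2 x)) ∧
      (LpN1 p (deriv (fun x1 => phiF V ψ1 x1 - phiF V ψ2 x1)) ≤
        (ENNReal.ofReal (32 * K ^ 4) * (WNorm 1 p ψ2) /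
              (ENNReal.ofReal (⨅ y : ℝ, marg ψ1 y) * ENNReal.ofReal (⨅ y : ℝ, marg ψ2 y)) +
            ENNReal.ofReal (32 * K ^ 4) *
                (WNorm 1 p ψ1 * WNorm 1 p ψ2 * (WNorm 1 p ψ1 + WNorm 1 p ψ2)) /
              ((ENNReal.ofReal (⨅ y : ℝ, marg ψ1 y)) ^ 2 *
                (ENNReal.ofReal (⨅ y : ℝ, marg ψ2 y)) ^ 2)) *
          WNorm 1 p (fun x => ψ1 x - ψ2 x)) := by
  have hK0 : 0 ≤ K := by linarith
  have hq : 1 ≤ ENNReal.ofReal p := by simpa using hp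
  have d12 : Differentiable ℝ fun x => ψ1 x - ψ2 x := d1.sub d2
  have f12 : WNorm 1 p (fun x => ψ1 x - ψ2 x) < ⊤ := by
    have mg : ∀ u : Spc m → ℝ, Measurable fun z => ‖grd u z‖ :=
      fun u => (measurable_fderiv ℝ u).norm
    rw [WN1] at f1 f2 ⊢
    rw [ENNReal.add_lt_top] at f1 f2 ⊢
    constructor
    · refine (eLpNorm_sub_le d1.continuous.aestronglyMeasurable
        d2.continuous.aestronglyMeasurable hq).trans_lt (ENNReal.add_lt_top.2 ⟨f1.1, f2.1⟩)
    · refine lt_of_le_of_lt ?_ (ENNReal.add_lt_top.2 ⟨f1.2, f2.2⟩)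
      refine le_trans (eLpNorm_mono_real (g := (fun z => ‖grd ψ1 z‖) + fun z => ‖grd ψ2 z‖) ?_)
        (eLpNorm_add_le (mg ψ1).aestronglyMeasurable (mg ψ2).aestronglyMeasurable hq)
      intro z
      rw [norm_norm]
      have : grd (fun x => ψ1 x - ψ2 x) z = grd ψ1 z - grd ψ2 z :=
        ((d1 z).hasFDerivAt.sub (d2 z).hasFDerivAt).fderiv
      rw [this]
      exact norm_sub_le _ _
  have ha1 := marg_inf_pos d1.continuous P1 g1
  have ha2 := marg_inf_pos d2.continuous P2 g2
  have hl1 := inf_le' g1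
  have hl2 := inf_le' g2
  set a1 := ⨅ y : ℝ, marg ψ1 y
  set a2 := ⨅ y : ℝ, marg ψ2 y
  -- the functions
  have mA : ∀ x, marg (fun z => pd (e1 m) V z * (ψ1 z - ψ2 z)) x
      = marg (fun z => pd (e1 m) V z * ψ1 z) x - marg (fun z => pd (e1 m) V z * ψ2 z) x :=
    marg_sub' hw.1 d1 d2
  have mM := marg_sub' ho.1 d1 d2
  have hA1 := fun x hx => est_d hw hK0 hp d1 f1 (x := x) hx
  have hA2 := fun x hx => est_d hw hK0 hp d2 f2 (x := x) hx
  have hA12 := fun x hx => est_d hw hK0 hp d12 f12 (x := x) hx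
  have hm1 := fun x hx => est_d ho hK0 hp d1 f1 (x := x) hx
  have hm2 := fun x hx => est_d ho hK0 hp d2 f2 (x := x) hx
  have hm12 := fun x hx => est_d ho hK0 hp d12 f12 (x := x) hx
  have eA2 := est_e hw hK0 hp d2 f2
  have eA1 := est_e hw hK0 hp d1 f1
  have em1 := est_e ho hK0 hp d1 f1
  have em2 := est_e ho hK0 hp d2 f2
  have cA2 := est_c hw hK0 hp d2 f2
  have cA12 := est_c hw hK0 hp d12 f12
  have cm2 := est_c ho hK0 hp d2 f2
  have cm12 := est_c ho hK0 hp d12 f12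
  have zA12 := est_a hw hK0 hp d12
  have zm12 := est_a ho hK0 hp d12
  have cA12c := (marg_cont (hw.1.mul d12).continuous).measurable
  have cm12c := (marg_cont (ho.1.mul d12).continuous).measurable
  simp only [one_mul] at mM hm1 hm2 hm12 em1 em2 cm2 cm12 zm12
  have cm12c' : Measurable (marg fun x => ψ1 x - ψ2 x) := (marg_cont d12.continuous).measurable
  have ph : ∀ ψ : Spc m → ℝ, phiF V ψ
      = fun x => marg (fun z => pd (e1 m) V z * ψ z) x / marg ψ x := fun ψ => rfl
  have l12 : LpN p (fun x => ψ1 x - ψ2 x) ≠ ⊤ := by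
    rw [WN1, ENNReal.add_lt_top] at f12
    exact f12.1.ne
  have q1 : WNorm 1 p ψ1 = ENNReal.ofReal (WNorm 1 p ψ1).toReal :=
    (ENNReal.ofReal_toReal f1.ne).symm
  have q2 : WNorm 1 p ψ2 = ENNReal.ofReal (WNorm 1 p ψ2).toReal :=
    (ENNReal.ofReal_toReal f2.ne).symm
  have q12 : WNorm 1 p (fun x => ψ1 x - ψ2 x)
      = ENNReal.ofReal (WNorm 1 p (fun x => ψ1 x - ψ2 x)).toReal :=
    (ENNReal.ofReal_toReal f12.ne).symm
  have qq : LpN p (fun x => ψ1 x - ψ2 x)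
      = ENNReal.ofReal (LpN p (fun x => ψ1 x - ψ2 x)).toReal :=
    (ENNReal.ofReal_toReal l12).symm
  have n1p : 0 ≤ (WNorm 1 p ψ1).toReal := ENNReal.toReal_nonneg
  have n2p : 0 ≤ (WNorm 1 p ψ2).toReal := ENNReal.toReal_nonneg
  have dp : 0 ≤ (WNorm 1 p (fun x => ψ1 x - ψ2 x)).toReal := ENNReal.toReal_nonneg
  have ep : 0 ≤ (LpN p (fun x => ψ1 x - ψ2 x)).toReal := ENNReal.toReal_nonneg
  rw [qq] at zA12 zm12 ⊢
  rw [q12] at cA12 cm12 ⊢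
  rw [q2] at cA2 cm2 ⊢
  rw [q1]
  generalize (WNorm 1 p ψ1).toReal = n1 at *
  generalize (WNorm 1 p ψ2).toReal = n2 at *
  generalize (WNorm 1 p (fun x => ψ1 x - ψ2 x)).toReal = d at *
  generalize (LpN p (fun x => ψ1 x - ψ2 x)).toReal = d0 at *
  have hKK : K ^ 2 ≤ K ^ 4 := pow_le_pow_right₀ hK (by norm_num)
  constructor
  · have key := lin4 hp (F := fun x1 => phiF V ψ1 x1 - phiF V ψ2 x1)
      cA12c cm12c' (measurable_const (a := (0 : ℝ))) (measurable_const (a := (0 : ℝ)))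
      (c1 := 2 * K * n2 / (a1 * a2)) (c2 := 2 * K * n2 / (a1 * a2)) (c3 := 0) (c4 := 0)
      (by positivity) (by positivity) le_rfl le_rfl (by
        filter_upwards [ae_restrict_mem measurableSet_Ico] with x hx
        rw [ph, ph]
        have := alg1 (A1 := marg (fun z => pd (e1 m) V z * ψ1 z) x) ha1 ha2 (hl1 x) (hl2 x)
          (hA2 x hx) (hm2 x hx)
        simp only [mM, zero_mul, add_zero]
        refine this.trans (le_of_eq ?_)
        congr 3
        exact (mA x).symm)
    refine key.trans ?_
    simp only [ENNReal.ofReal_zero, zero_mul, add_zero]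
    refine (add_le_add (mul_le_mul_right zA12 _) (mul_le_mul_right zm12 _)).trans ?_
    rw [← ENNReal.ofReal_mul (by positivity), ← ENNReal.ofReal_mul (by positivity),
      ← ENNReal.ofReal_add (by positivity) (by positivity),
      ← ENNReal.ofReal_mul (by positivity), ← ENNReal.ofReal_mul (by positivity),
      ← ENNReal.ofReal_div_of_pos (by positivity), ← ENNReal.ofReal_mul (by positivity)]
    apply ENNReal.ofReal_le_ofReal
    calc _ = 4 * K ^ 2 * (n2 / (a1 * a2) * d0) := by ring
      _ ≤ 32 * K ^ 4 * (n2 / (a1 * a2) * d0) := by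
        gcongr
        norm_num
      _ = _ := by ring
  · have key := lin4 hp (F := deriv fun x1 => phiF V ψ1 x1 - phiF V ψ2 x1)
      (measurable_deriv (marg fun z => pd (e1 m) V z * (ψ1 z - ψ2 z)))
      (measurable_deriv (marg fun z => pd (e1 m) V z * ψ2 z))
      (measurable_deriv (marg fun z => ψ1 z - ψ2 z))
      (measurable_deriv (marg fun z => ψ2 z))
      (c1 := 2 * K * n2 / (a1 * a2)) (c2 := 2 * K * d / (a1 * a2))
      (c3 := (2 * K * n1) * (2 * K * n2) ^ 2 / (a1 ^ 2 * a2 ^ 2))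
      (c4 := 3 * (2 * K * n1) * (2 * K * n2) * (2 * K * d) / (a1 ^ 2 * a2 ^ 2))
      (by positivity) (by positivity) (by positivity) (by positivity) (by
        filter_upwards [ae_restrict_mem measurableSet_Ico, eA1, eA2, em1, em2]
          with x hx xA1 xA2 xm1 xm2
        rw [ph, ph, funext mA, funext mM]
        have r := ((xA1.hasDerivAt.div xm1.hasDerivAt (g1 x).ne').sub
          (xA2.hasDerivAt.div xm2.hasDerivAt (g2 x).ne')).deriv
        have rA := (xA1.hasDerivAt.sub xA2.hasDerivAt).deriv
        have rm := (xm1.hasDerivAt.sub xm2.hasDerivAt).deriv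
        have := alg2 (B1 := deriv (marg fun z => pd (e1 m) V z * ψ1 z) x)
          (B2 := deriv (marg fun z => pd (e1 m) V z * ψ2 z) x)
          (r1 := deriv (marg fun z => ψ1 z) x) (r2 := deriv (marg fun z => ψ2 z) x)
          ha1 ha2 (hl1 x) (hl2 x) (hA1 x hx) (hm1 x hx) (hA2 x hx) (hm2 x hx)
          ((mA x) ▸ hA12 x hx) ((mM x) ▸ hm12 x hx)
        rw [← rA, ← rm, ← r] at this
        exact this)
    refine key.trans ?_
    refine (add_le_add (add_le_add (add_le_add (mul_le_mul_right cA12 _)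
      (mul_le_mul_right cA2 _)) (mul_le_mul_right cm12 _)) (mul_le_mul_right cm2 _)).trans ?_
    rw [← ENNReal.ofReal_pow ha1.le, ← ENNReal.ofReal_pow ha2.le,
      ← ENNReal.ofReal_add n1p n2p]
    repeat rw [← ENNReal.ofReal_mul (by positivity)]
    rw [← ENNReal.ofReal_div_of_pos (by positivity), ← ENNReal.ofReal_div_of_pos (by positivity)]
    repeat rw [← ENNReal.ofReal_add (by positivity) (by positivity)]
    rw [← ENNReal.ofReal_mul (by positivity)]
    apply ENNReal.ofReal_le_ofReal
    calc _ = 4 * K ^ 2 * (n2 / (a1 * a2) * d)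
          + 32 * K ^ 4 * (n1 * n2 * n2 / (a1 ^ 2 * a2 ^ 2) * d) := by ring
      _ ≤ 32 * K ^ 4 * (n2 / (a1 * a2) * d)
          + 32 * K ^ 4 * (n1 * n2 * (n1 + n2) / (a1 ^ 2 * a2 ^ 2) * d) := by
        gcongr
        · norm_num
        · linarith
      _ = _ := by ring

/-- **Lipschitz estimates for `ψ ↦ φ_ψ` (Lemma `majfi`).** Assume `[H₂]`. There is a constant
`C` depending only on `V` such that for all `ψ₁, ψ₂ ∈ 𝒟^{σ,p}(𝕋ⁿ)`:
`‖φ_{ψ₁} − φ_{ψ₂}‖_p ≤ C min(‖ψ₁‖_{1,p}, ‖ψ₂‖_{1,p})/(min ψ̄₁ min ψ̄₂) ‖ψ₁ − ψ₂‖_p` and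
`‖∂_{x₁}(φ_{ψ₁} − φ_{ψ₂})‖_p ≤ [C min(‖ψ₁‖_{σ,p}, ‖ψ₂‖_{σ,p})/(min ψ̄₁ min ψ̄₂)
 + C ‖ψ₁‖_{σ,p}‖ψ₂‖_{σ,p}(‖ψ₁‖_{σ,p} + ‖ψ₂‖_{σ,p})/((min ψ̄₁)²(min ψ̄₂)²)] ‖ψ₁ − ψ₂‖_{1,p}`. -/
theorem phi_lipschitz_estimates
    (m : ℕ) (V : Spc m → ℝ) (σ p : ℝ)
    (hV : ContDiff ℝ 2 V) (hVper : IsPeriodic V) (h2 : Hyp2 m σ p) :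
    ∃ C : ℝ, 0 < C ∧ ∀ ψ1 ψ2 : Spc m → ℝ, MemD σ p ψ1 → MemD σ p ψ2 →
      (LpN1 p (fun x1 => phiF V ψ1 x1 - phiF V ψ2 x1) ≤
        ENNReal.ofReal C * min (WNorm 1 p ψ1) (WNorm 1 p ψ2) /
            (ENNReal.ofReal (⨅ y : ℝ, marg ψ1 y) * ENNReal.ofReal (⨅ y : ℝ, marg ψ2 y)) *
          LpN p (fun x => ψ1 x - ψ2 x)) ∧
      (LpN1 p (deriv (fun x1 => phiF V ψ1 x1 - phiF V ψ2 x1)) ≤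
        (ENNReal.ofReal C * min (WNorm σ p ψ1) (WNorm σ p ψ2) /
              (ENNReal.ofReal (⨅ y : ℝ, marg ψ1 y) * ENNReal.ofReal (⨅ y : ℝ, marg ψ2 y)) +
            ENNReal.ofReal C *
                (WNorm σ p ψ1 * WNorm σ p ψ2 * (WNorm σ p ψ1 + WNorm σ p ψ2)) /
              ((ENNReal.ofReal (⨅ y : ℝ, marg ψ1 y)) ^ 2 *
                (ENNReal.ofReal (⨅ y : ℝ, marg ψ2 y)) ^ 2)) *
          WNorm 1 p (fun x => ψ1 x - ψ2 x)) := by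

  obtain ⟨K, hK, hw, ho⟩ := exists_K hV
  obtain ⟨hm, hp, hs, hs2⟩ := h2
  have hm0 : (0 : ℝ) ≤ m := Nat.cast_nonneg m
  have hp1 : 1 ≤ p := by linarith
  have hσ : 1 < σ := by
    have : 0 ≤ ((m : ℝ) + 1) / p := by positivity
    linarith
  refine ⟨32 * K ^ 4, by positivity, fun ψ1 ψ2 h1 h2 => ?_⟩
  obtain ⟨⟨P1, -, D1, -, F1⟩, g1⟩ := h1
  obtain ⟨⟨P2, -, D2, -, F2⟩, g2⟩ := h2
  have L1 : WNorm 1 p ψ1 ≤ WNorm σ p ψ1 := WN1_le hσ hs2 ψ1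
  have L2 : WNorm 1 p ψ2 ≤ WNorm σ p ψ2 := WN1_le hσ hs2 ψ2
  obtain ⟨A, B⟩ := one_side hK hw ho hp1 (D1 hσ.le) (D2 hσ.le) P1 P2 (L1.trans_lt F1)
    (L2.trans_lt F2) g1 g2
  obtain ⟨A', B'⟩ := one_side hK hw ho hp1 (D2 hσ.le) (D1 hσ.le) P2 P1 (L2.trans_lt F2)
    (L1.trans_lt F1) g2 g1
  have s1 : LpN1 p (fun x1 => phiF V ψ2 x1 - phiF V ψ1 x1)
      = LpN1 p (fun x1 => phiF V ψ1 x1 - phiF V ψ2 x1) := eLpNorm_sub_comm _ _ _ _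
  have s2 : LpN1 p (deriv fun x1 => phiF V ψ2 x1 - phiF V ψ1 x1)
      = LpN1 p (deriv fun x1 => phiF V ψ1 x1 - phiF V ψ2 x1) := by
    have : (deriv fun x1 => phiF V ψ2 x1 - phiF V ψ1 x1)
        = -(deriv fun x1 => phiF V ψ1 x1 - phiF V ψ2 x1) := by
      funext x
      rw [Pi.neg_apply, ← deriv.fun_neg]
      congr 1
      funext y
      ring
    rw [this]
    exact eLpNorm_neg _ _ _
  have s3 : LpN p (fun x => ψ2 x - ψ1 x) = LpN p (fun x => ψ1 x - ψ2 x) :=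
    eLpNorm_sub_comm _ _ _ _
  have s4 : WNorm 1 p (fun x => ψ2 x - ψ1 x) = WNorm 1 p (fun x => ψ1 x - ψ2 x) := by
    rw [WN1, WN1, s3]
    congr 2
    funext x
    have : grd (fun x => ψ2 x - ψ1 x) x = -grd (fun x => ψ1 x - ψ2 x) x := by
      unfold grd
      rw [← fderiv_fun_neg]
      congr 1
      funext y
      ring
    rw [this, norm_neg]
  rw [s1, s3] at A'
  rw [s2, s4] at B'
  rw [mul_comm (ENNReal.ofReal (⨅ y : ℝ, marg ψ2 y))] at A'
  rw [mul_comm (ENNReal.ofReal (⨅ y : ℝ, marg ψ2 y)), mul_comm (WNorm 1 p ψ2),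
    add_comm (WNorm 1 p ψ2), mul_comm (ENNReal.ofReal (⨅ y : ℝ, marg ψ2 y) ^ 2)] at B'
  constructor
  · rcases le_total (WNorm 1 p ψ1) (WNorm 1 p ψ2) with h | h
    · rw [min_eq_left h]; exact A'
    · rw [min_eq_right h]; exact A
  · rcases le_total (WNorm σ p ψ1) (WNorm σ p ψ2) with h | h
    · rw [min_eq_left h]
      refine B'.trans ?_
      gcongr
    · rw [min_eq_right h]
      refine B.trans ?_
      gcongr
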